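/- arXiv:2510.23259 — 2 statements merged into one kernel-verified Lean document; each statement's English description precedes it below -/
import Mathlib

section
/- Let E be a real inner product space, let x, y, c₁, c₂ ∈ E, and let t, s ≥ 0. Suppose ⟨x − y, c₁ − x⟩ ≥ 0 and ⟨y − x, c₂ − y⟩ ≥ 0 (each boundary point's cluster center lies on the far side of the other point). Then after the contraction step x' = x + t·(c₁ − x) and y' = y + s·(c₂ − y), the distance does not decrease: ‖x' − y'‖ ≥ ‖x − y‖. -/
open scoped RealInnerProductSpace

/-- Boundary Clarity (weak form): if each boundary point's cluster center lies on the far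
side of the other point, then contracting each point toward its own cluster center does not
decrease the distance between them. -/
theorem boundary_clarity_weak {E : Type*} [NormedAddCommGroup E] [InnerProductSpace ℝ E]
    (x y c₁ c₂ : E) (t s : ℝ) (ht : 0 ≤ t) (hs : 0 ≤ s)
    (h₁ : 0 ≤ ⟪x - y, c₁ - x⟫) (h₂ : 0 ≤ ⟪y - x, c₂ - y⟫) :
    ‖x - y‖ ≤ ‖(x + t • (c₁ - x)) - (y + s • (c₂ - y))‖ := by
  have hw : 0 ≤ ⟪x - y, t • (c₁ - x) - s • (c₂ - y)⟫ := by
    rw [← neg_sub x y, inner_neg_left] at h₂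
    rw [inner_sub_right, real_inner_smul_right, real_inner_smul_right]
    linarith [mul_nonneg ht h₁, mul_nonneg hs h₂]
  rw [add_sub_add_comm]
  refine (sq_le_sq₀ (norm_nonneg _) (norm_nonneg _)).mp ?_
  rw [norm_add_sq_real]
  linarith [sq_nonneg ‖t • (c₁ - x) - s • (c₂ - y)‖]
end

section
/- Let E be a real inner product space, let x, y, c₁, c₂ ∈ E, and let t > 0, s ≥ 0. Suppose ⟨x − y, c₁ − x⟩ > 0 and ⟨y − x, c₂ − y⟩ ≥ 0. Then after the contraction step x' = x + t·(c₁ − x) and y' = y + s·(c₂ − y), the distance strictly increases: ‖x' − y'‖ > ‖x − y‖. -/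
open scoped RealInnerProductSpace

/-- Boundary Clarity (strict form): under a strictly separating inner-product condition,
contracting each boundary point toward its own cluster center strictly increases the
distance between them. -/
theorem boundary_clarity_strict {E : Type*} [NormedAddCommGroup E] [InnerProductSpace ℝ E]
    (x y c₁ c₂ : E) (t s : ℝ) (ht : 0 < t) (hs : 0 ≤ s)
    (h₁ : 0 < ⟪x - y, c₁ - x⟫) (h₂ : 0 ≤ ⟪y - x, c₂ - y⟫) :
    ‖x - y‖ < ‖(x + t • (c₁ - x)) - (y + s • (c₂ - y))‖ := by
  have key : ⟪x - y, (x + t • (c₁ - x)) - (y + s • (c₂ - y))⟫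
      = ‖x - y‖ * ‖x - y‖ + t * ⟪x - y, c₁ - x⟫ + s * ⟪y - x, c₂ - y⟫ := by
    rw [show (x + t • (c₁ - x)) - (y + s • (c₂ - y))
        = (x - y) + t • (c₁ - x) - s • (c₂ - y) by abel, ← neg_sub x y, inner_neg_left,
      inner_sub_right, inner_add_right, real_inner_smul_right, real_inner_smul_right,
      real_inner_self_eq_norm_mul_norm]
    ring
  have hcs := real_inner_le_norm (x - y) ((x + t • (c₁ - x)) - (y + s • (c₂ - y)))
  have hpos := mul_pos ht h₁
  have hnonneg := mul_nonneg hs h₂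
  exact lt_of_mul_lt_mul_left (by linarith) (norm_nonneg (x - y))
end
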